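/- arXiv:2105.01936 — 3 statements merged into one kernel-verified Lean document; each statement's English description precedes it below -/
import Mathlib

section
/- Algebraic independence of the deformed shifted power sums: Let n, m ∈ ℕ and let q, t ∈ ℂ∖{0} be non-special, i.e., q^i t^j ≠ 1 for all i, j ∈ ℕ with i + j ≥ 1. Then the n + m polynomials p♮_1, p♮_2, …, p♮_{n+m} in ℂ[x_1,…,x_n,y_1,…,y_m], where p♮_r(x,y) = Σ_{i=1}^{n} (x_i^r - 1) t^{r(1-i)} + ((1-q^r)/(1-t^{-r})) Σ_{j=1}^{m} (y_j^r - t^{-rn}) q^{r(j-1)}, are algebraically independent over ℂ. -/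
open MvPolynomial

noncomputable section

/-- The deformed shifted power sum `p♮_r` as a polynomial in the `n + m` variables
`x_1,…,x_n,y_1,…,y_m` (`0`-based indices: the term for `i : Fin n` carries
`t^{r(1-(i+1))} = t^{-r i}`, and the term for `j : Fin m` carries
`q^{r((j+1)-1)} = q^{r j}`). -/
def pnatPoly (n m : ℕ) (q t : ℂ) (r : ℕ) : MvPolynomial (Fin n ⊕ Fin m) ℂ :=
  (∑ i : Fin n, (X (Sum.inl i) ^ r - 1) * C (t ^ (-((r : ℤ) * ((i : ℕ) : ℤ)))))
    + C ((1 - q ^ r) / (1 - t ^ (-(r : ℤ))))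
        * ∑ j : Fin m, (X (Sum.inr j) ^ r - C (t ^ (-((r : ℤ) * (n : ℤ)))))
            * C (q ^ (r * (j : ℕ)))

section Jacobian

variable {R σ τ : Type*} [CommRing R]

theorem totalDegree_pderiv_le_of_le_succ {d : ℕ} {F : MvPolynomial σ R}
    (hF : F.totalDegree ≤ d + 1) (i : σ) : (pderiv i F).totalDegree ≤ d := by
  classical
  refine Finset.sup_le fun m hm ↦ ?_
  have hm' : m + Finsupp.single i 1 ∈ F.support := by
    rw [mem_support_iff] at hm ⊢
    rw [coeff_pderiv] at hm
    exact left_ne_zero_of_mul hm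
  have h := (le_totalDegree hm').trans hF
  rw [Finsupp.sum_add_index' (by simp) (by simp), Finsupp.sum_single_index rfl] at h
  omega

theorem eq_C_of_forall_pderiv_eq_zero [NoZeroDivisors R] [CharZero R] {F : MvPolynomial σ R}
    (hF : ∀ i, pderiv i F = 0) : F = C (coeff 0 F) := by
  classical
  ext m
  rw [coeff_C]
  split_ifs with hm
  · rw [hm]
  obtain ⟨i, hi⟩ := Finsupp.ne_iff.mp (Ne.symm hm)
  have hle : Finsupp.single i 1 ≤ m := by
    rw [Finsupp.single_le_iff]
    exact Nat.one_le_iff_ne_zero.mpr hi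
  have h := congrArg (coeff (m - Finsupp.single i 1)) (hF i)
  rw [coeff_pderiv, tsub_add_cancel_of_le hle, coeff_zero] at h
  refine (mul_eq_zero.mp h).resolve_right ?_
  exact Nat.cast_add_one_ne_zero _

theorem derivation_aeval_eq_sum {A : Type*} [CommRing A] [Algebra R A] [Fintype τ]
    (D : Derivation R A A) (p : τ → A) (F : MvPolynomial τ R) :
    D (aeval p F) = ∑ r, aeval p (pderiv r F) * D (p r) := by
  classical
  induction F using MvPolynomial.induction_on with
  | C a => simp
  | add f g hf hg => simp [hf, hg, add_mul, Finset.sum_add_distrib]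
  | mul_X f s hf =>
    simp only [map_mul, aeval_X, Derivation.leibniz, hf, smul_eq_mul, pderiv_X, map_add, add_mul,
      Finset.sum_add_distrib, Finset.mul_sum]
    congr 1
    · rw [Finset.sum_eq_single s] <;> simp +contextual [eq_comm]
    · exact Finset.sum_congr rfl fun _ _ ↦ by ring

/-- The **Jacobian criterion**: polynomials over a domain of characteristic zero with nonvanishing
Jacobian determinant are algebraically independent. -/
theorem algebraicIndependent_of_det_pderiv_ne_zero [IsDomain R] [CharZero R] [Fintype τ]
    [DecidableEq τ] (e : τ → σ) (p : τ → MvPolynomial σ R)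
    (hp : (Matrix.of fun r k ↦ pderiv (e k) (p r)).det ≠ 0) : AlgebraicIndependent R p := by
  rw [algebraicIndependent_iff]
  suffices h : ∀ d : ℕ, ∀ F : MvPolynomial τ R, F.totalDegree ≤ d → aeval p F = 0 → F = 0 from
    fun F hF ↦ h _ F le_rfl hF
  have hconst : ∀ c : R, aeval p (C c : MvPolynomial τ R) = 0 → c = 0 := by
    intro c hc
    simpa using hc
  intro d
  induction d with
  | zero =>
    intro F hd hF
    rw [totalDegree_eq_zero_iff_eq_C.mp (Nat.le_zero.mp hd)] at hF ⊢
    rw [hconst _ hF, C_0]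
  | succ d ih =>
    intro F hd hF
    have hvec : (fun r ↦ aeval p (pderiv r F)) = 0 := by
      refine Matrix.eq_zero_of_vecMul_eq_zero hp (funext fun k ↦ ?_)
      simp only [Matrix.vecMul, dotProduct, Matrix.of_apply, Pi.zero_apply]
      rw [← derivation_aeval_eq_sum, hF, map_zero]
    have hder : ∀ r, pderiv r F = 0 := fun r ↦
      ih _ (totalDegree_pderiv_le_of_le_succ hd r) (congrFun hvec r)
    rw [eq_C_of_forall_pderiv_eq_zero hder] at hF ⊢
    rw [hconst _ hF, C_0]

/-- A generalized Vandermonde determinant with nonzero coefficients does not vanish: distinct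
permutations contribute distinct monomials. -/
theorem det_C_mul_X_pow_ne_zero [IsDomain R] {N : ℕ} (e : Fin N ≃ σ)
    (d : Fin N → Fin N → R) (hd : ∀ r k, d r k ≠ 0) :
    (Matrix.of fun r k : Fin N ↦ C (d r k) * X (e k) ^ (r : ℕ)).det ≠
      (0 : MvPolynomial σ R) := by
  classical
  let expo (π : Equiv.Perm (Fin N)) : σ →₀ ℕ := ∑ k, Finsupp.single (e k) (π k : ℕ)
  have hexpo (π : Equiv.Perm (Fin N)) (k : Fin N) : expo π (e k) = π k := by
    simp [expo, Finsupp.finsetSum_apply, Finsupp.single_apply]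
  have hinj (π : Equiv.Perm (Fin N)) (h : expo π = expo 1) : π = 1 := by
    ext k
    rw [← hexpo π k, ← hexpo 1 k, h]
  have hprod (π : Equiv.Perm (Fin N)) :
      ∏ k, (C (d (π k) k) * X (e k) ^ (π k : ℕ) : MvPolynomial σ R) =
        monomial (expo π) (∏ k, d (π k) k) := by
    simp only [C_mul_X_pow_eq_monomial, expo, monomial_sum_prod]
  intro h
  have hc := congrArg (coeff (expo 1)) h
  simp only [Matrix.det_apply, Matrix.of_apply, hprod, coeff_sum, coeff_zero] at hc
  rw [Finset.sum_eq_single 1 (fun π _ hπ ↦ ?_) (by simp)] at hc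
  · rw [Equiv.Perm.sign_one, one_smul, coeff_monomial, if_pos rfl] at hc
    exact Finset.prod_ne_zero_iff.mpr (fun k _ ↦ hd _ _) hc
  · rw [Units.smul_def, coeff_smul, coeff_monomial, if_neg fun h ↦ hπ (hinj π h), smul_zero]

end Jacobian

theorem pderiv_inl_pnatPoly (n m : ℕ) (q t : ℂ) (r : ℕ) (i : Fin n) :
    pderiv (Sum.inl i) (pnatPoly n m q t (r + 1)) =
      C ((r + 1 : ℂ) * t ^ (-(((r + 1 : ℕ) : ℤ) * ((i : ℕ) : ℤ)))) * X (Sum.inl i) ^ r := by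
  classical
  simp [pnatPoly, Derivation.leibniz, pderiv_X, Pi.single_apply]
  ring

theorem pderiv_inr_pnatPoly (n m : ℕ) (q t : ℂ) (r : ℕ) (j : Fin m) :
    pderiv (Sum.inr j) (pnatPoly n m q t (r + 1)) =
      C ((r + 1 : ℂ) * ((1 - q ^ (r + 1)) / (1 - t ^ (-((r + 1 : ℕ) : ℤ)))) *
        q ^ ((r + 1) * (j : ℕ))) * X (Sum.inr j) ^ r := by
  classical
  simp [pnatPoly, Derivation.leibniz, pderiv_X, Pi.single_apply]
  ring

/-- **Algebraic independence of the deformed shifted power sums**: for non-special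
`q, t ∈ ℂ∖{0}`, the polynomials `p♮_1, …, p♮_{n+m}` are algebraically independent
over `ℂ`. -/
theorem pnatPoly_algebraicIndependent (n m : ℕ) (q t : ℂ)
    (hq : q ≠ 0) (ht : t ≠ 0)
    (hns : ∀ i j : ℕ, 1 ≤ i + j → q ^ i * t ^ j ≠ 1) :
    AlgebraicIndependent ℂ (fun r : Fin (n + m) => pnatPoly n m q t ((r : ℕ) + 1)) := by
  have hcoeff (r : ℕ) (v : Fin n ⊕ Fin m) : ∃ c : ℂ, c ≠ 0 ∧
      pderiv v (pnatPoly n m q t (r + 1)) = C c * X v ^ r := by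
    have hr : (r + 1 : ℂ) ≠ 0 := Nat.cast_add_one_ne_zero r
    cases v with
    | inl i => exact ⟨_, mul_ne_zero hr (zpow_ne_zero _ ht), pderiv_inl_pnatPoly n m q t r i⟩
    | inr j =>
      have hqr : 1 - q ^ (r + 1) ≠ 0 := by
        rw [sub_ne_zero]
        simpa using (hns (r + 1) 0 (by omega)).symm
      have htr : 1 - t ^ (-((r + 1 : ℕ) : ℤ)) ≠ 0 := by
        rw [sub_ne_zero, zpow_neg, zpow_natCast, ne_comm, inv_ne_one]
        simpa using hns 0 (r + 1) (by omega)
      exact ⟨_, mul_ne_zero (mul_ne_zero hr (div_ne_zero hqr htr)) (pow_ne_zero _ hq),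
        pderiv_inr_pnatPoly n m q t r j⟩
  choose c hc hpderiv using hcoeff
  refine algebraicIndependent_of_det_pderiv_ne_zero finSumFinEquiv.symm _ ?_
  simp only [hpderiv]
  exact det_C_mul_X_pow_ne_zero finSumFinEquiv.symm (fun r k ↦ c r (finSumFinEquiv.symm k))
    fun _ _ ↦ hc _ _
end
end

section
/- Vandermonde/q-shifted factorial identity used to rewrite the deformed Macdonald–Ruijsenaars coefficients: Let m ∈ ℕ, t ∈ ℂ∖{0} not a root of unity, μ ∈ ℕ^m, and y ∈ ℂ^m. Then, provided all factors occurring in a denominator are nonzero, (Δ(t^{-μ} y)/Δ(y)) · ∏_{i,j=1}^{m} 1/(y_i/(t y_j); t^{-1})_{μ_i} = (-1)^{|μ|} t^{|μ|(|μ|+1)/2} ∏_{i,j=1}^{m} 1/(t^{μ_j} y_i/y_j; t^{-1})_{μ_i}, where |μ| = μ_1 + ⋯ + μ_m. -/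
open Finset

noncomputable section

/-- Finite `q`-Pochhammer symbol `(a;q)_k = ∏_{i=0}^{k-1} (1 - a q^i)`. -/
def qPoch (a q : ℂ) (k : ℕ) : ℂ := ∏ i ∈ Finset.range k, (1 - a * q ^ i)

/-- Vandermonde-type product `Δ(y) = ∏_{i<j} (y_i - y_j)`. -/
def vand {m : ℕ} (y : Fin m → ℂ) : ℂ := ∏ i : Fin m, ∏ j ∈ Finset.Ioi i, (y i - y j)

theorem qPoch_add (a q : ℂ) (m n : ℕ) :
    qPoch a q (m + n) = qPoch a q m * qPoch (a * q ^ m) q n := by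
  simp only [qPoch, Finset.prod_range_add, pow_add, mul_assoc]

theorem mul_succ_div_two_succ (n : ℕ) :
    (n + 1) * (n + 1 + 1) / 2 = n * (n + 1) / 2 + (n + 1) := by
  rw [show (n + 1) * (n + 1 + 1) = n * (n + 1) + (n + 1) * 2 by ring,
    Nat.add_mul_div_right _ _ two_pos]

/-- Reversing the order of the factors of a `q`-Pochhammer symbol of base `t⁻¹`. -/
theorem qPoch_inv_reverse {t z : ℂ} (ht : t ≠ 0) (hz : z ≠ 0) (n : ℕ) :
    qPoch (t ^ n * z) t⁻¹ n
      = (-z) ^ n * t ^ (n * (n + 1) / 2) * qPoch (t * z)⁻¹ t⁻¹ n := by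
  induction n with
  | zero => simp [qPoch]
  | succ n ih =>
    have h₁ : qPoch (t ^ (n + 1) * z) t⁻¹ (n + 1)
        = (1 - t ^ (n + 1) * z) * qPoch (t ^ n * z) t⁻¹ n := by
      rw [add_comm n 1, qPoch_add]
      congr 1
      · simp [qPoch]
      · congr 1
        field_simp
        ring
    have h₂ : qPoch (t * z)⁻¹ t⁻¹ (n + 1)
        = qPoch (t * z)⁻¹ t⁻¹ n * (1 - (t * z)⁻¹ * t⁻¹ ^ n) := by
      simp only [qPoch, Finset.prod_range_succ]
    have h₃ : 1 - t ^ (n + 1) * z = -z * t ^ (n + 1) * (1 - (t * z)⁻¹ * t⁻¹ ^ n) := by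
      rw [inv_pow]
      field_simp
      ring
    rw [h₁, h₂, h₃, ih, mul_succ_div_two_succ, pow_add t (n * (n + 1) / 2)]
    ring

theorem qPoch_pair_identity {t x y : ℂ} (ht : t ≠ 0) (hx : x ≠ 0) (hy : y ≠ 0) (a b : ℕ) :
    (t ^ (-(a : ℤ)) * x - t ^ (-(b : ℤ)) * y)
        * (qPoch (t ^ a * y / x) t⁻¹ b * qPoch (t ^ b * x / y) t⁻¹ a)
      = t ^ (a * b) * (x - y)
        * (qPoch (y / (t * x)) t⁻¹ b * qPoch (x / (t * y)) t⁻¹ a) := by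
  have hz : x / y ≠ 0 := div_ne_zero hx hy
  have hw : x / y * t⁻¹ ^ (a + 1) ≠ 0 := mul_ne_zero hz (pow_ne_zero _ (inv_ne_zero ht))
  have h₁ : qPoch (t ^ b * (x / y)) t⁻¹ (b + (1 + a))
      = qPoch (t ^ b * (x / y)) t⁻¹ b * ((1 - x / y) * qPoch (x / (t * y)) t⁻¹ a) := by
    rw [qPoch_add, qPoch_add _ _ 1 a]
    have e₁ : t ^ b * (x / y) * t⁻¹ ^ b = x / y := by rw [inv_pow]; field_simp
    have e₂ : x / y * t⁻¹ ^ 1 = x / (t * y) := by field_simp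
    rw [e₁, e₂]
    simp [qPoch]
  have h₂ : qPoch (t ^ b * (x / y)) t⁻¹ (a + (1 + b))
      = qPoch (t ^ b * (x / y)) t⁻¹ a * ((1 - t ^ b * (x / y) * t⁻¹ ^ a)
        * qPoch (t ^ b * (x / y * t⁻¹ ^ (a + 1))) t⁻¹ b) := by
    rw [qPoch_add, qPoch_add _ _ 1 b]
    have e : t ^ b * (x / y) * t⁻¹ ^ a * t⁻¹ ^ 1 = t ^ b * (x / y * t⁻¹ ^ (a + 1)) := by ring
    rw [e]
    simp [qPoch]
  have e₁ : (t * (x / y))⁻¹ = y / (t * x) := by field_simp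
  have e₂ : (t * (x / y * t⁻¹ ^ (a + 1)))⁻¹ = t ^ a * y / x := by
    rw [inv_pow]
    field_simp
    ring
  have h := h₁
  rw [show b + (1 + a) = a + (1 + b) by ring, h₂] at h
  rw [qPoch_inv_reverse ht hz, qPoch_inv_reverse ht hw, e₁, e₂] at h
  rw [mul_div_assoc (t ^ b) x y]
  have hc : (-(x / y)) ^ b * t ^ (b * (b + 1) / 2) ≠ 0 :=
    mul_ne_zero (pow_ne_zero _ (neg_ne_zero.2 hz)) (pow_ne_zero _ ht)
  have h' : (1 - x / y) * (qPoch (y / (t * x)) t⁻¹ b * qPoch (x / (t * y)) t⁻¹ a)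
      = t⁻¹ ^ ((a + 1) * b) * (1 - t ^ b * (x / y) * t⁻¹ ^ a)
        * (qPoch (t ^ a * y / x) t⁻¹ b * qPoch (t ^ b * (x / y)) t⁻¹ a) := by
    refine mul_left_cancel₀ hc ?_
    rw [← neg_mul, mul_pow, ← pow_mul] at h
    linear_combination -h
  have h₃ : x - y = -y * (1 - x / y) := by
    field_simp
    ring
  have h₄ : t ^ (-(a : ℤ)) * x - t ^ (-(b : ℤ)) * y
      = -y * t⁻¹ ^ b * (1 - t ^ b * (x / y) * t⁻¹ ^ a) := by
    simp only [zpow_neg, zpow_natCast, inv_pow]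
    field_simp
    ring
  have h₅ : t ^ (a * b) * t⁻¹ ^ ((a + 1) * b) = t⁻¹ ^ b := by
    rw [add_mul, one_mul, pow_add, ← mul_assoc, ← mul_pow, mul_inv_cancel₀ ht, one_pow, one_mul]
  rw [h₃, h₄, ← h₅]
  linear_combination y * t ^ (a * b) * h'

theorem sum_mul_succ_div_two {m : ℕ} (μ : Fin m → ℕ) :
    (∑ i, μ i) * ((∑ i, μ i) + 1) / 2
      = ∑ i, μ i * (μ i + 1) / 2 + ∑ i, ∑ j ∈ Finset.Ioi i, μ i * μ j := by
  have key : (∑ i, μ i) * ((∑ i, μ i) + 1)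
      = (∑ i, μ i * (μ i + 1) / 2 + ∑ i, ∑ j ∈ Finset.Ioi i, μ i * μ j) * 2 := by
    have h₁ : (∑ i, μ i * (μ i + 1) / 2) * 2 = ∑ i, μ i * μ i + ∑ i, μ i := by
      rw [Finset.sum_mul, ← Finset.sum_add_distrib]
      refine Finset.sum_congr rfl fun i _ => ?_
      rw [Nat.div_mul_cancel (Nat.even_mul_succ_self _).two_dvd]
      ring
    have h₂ : (∑ i, ∑ j ∈ Finset.Ioi i, μ i * μ j) * 2 = ∑ i, ∑ j ∈ {i}ᶜ, μ j * μ i := by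
      rw [← Finset.sum_sum_Ioi_add_eq_sum_sum_off_diag (fun i j => μ i * μ j)]
      simp only [Finset.sum_mul]
      refine Finset.sum_congr rfl fun i _ => Finset.sum_congr rfl fun j _ => ?_
      ring
    have h₃ : (∑ i, μ i) * ∑ i, μ i = ∑ i, μ i * μ i + ∑ i, ∑ j ∈ {i}ᶜ, μ j * μ i := by
      rw [Finset.sum_mul_sum, ← Finset.sum_add_distrib]
      refine Finset.sum_congr rfl fun i _ => ?_
      rw [Fintype.sum_eq_add_sum_compl i]
      simp only [mul_comm]
    rw [add_mul, h₁, h₂, mul_add, h₃]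
    ring
  rw [key, Nat.mul_div_cancel _ two_pos]

theorem prod_prod_eq_diag_mul_Ioi {m : ℕ} (f : Fin m → Fin m → ℂ) :
    ∏ i, ∏ j, f i j = (∏ i, f i i) * ∏ i, ∏ j ∈ Finset.Ioi i, (f j i * f i j) := by
  rw [Finset.prod_prod_Ioi_mul_eq_prod_prod_off_diag, ← Finset.prod_mul_distrib,
    Finset.prod_comm]
  exact Finset.prod_congr rfl fun i _ => Fintype.prod_eq_mul_prod_compl i fun j => f j i

/-- The denominator-free form of `vandermonde_qPoch_identity`. -/
theorem vand_mul_prod_qPoch {m : ℕ} {t : ℂ} (ht : t ≠ 0) (μ : Fin m → ℕ) (y : Fin m → ℂ)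
    (hy : ∀ j, y j ≠ 0) :
    vand (fun i => t ^ (-(μ i : ℤ)) * y i)
        * ∏ i, ∏ j, qPoch (t ^ μ j * y i / y j) t⁻¹ (μ i)
      = (-1 : ℂ) ^ (∑ i, μ i) * t ^ ((∑ i, μ i) * ((∑ i, μ i) + 1) / 2) * vand y
        * ∏ i, ∏ j, qPoch (y i / (t * y j)) t⁻¹ (μ i) := by
  have hdiag : ∏ i, qPoch (t ^ μ i * y i / y i) t⁻¹ (μ i)
      = (-1 : ℂ) ^ (∑ i, μ i) * t ^ (∑ i, μ i * (μ i + 1) / 2)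
        * ∏ i, qPoch (y i / (t * y i)) t⁻¹ (μ i) := by
    simp only [← Finset.prod_pow_eq_pow_sum, ← Finset.prod_mul_distrib]
    refine Finset.prod_congr rfl fun i _ => ?_
    have h := qPoch_inv_reverse ht one_ne_zero (μ i)
    rwa [show t ^ μ i * 1 = t ^ μ i * y i / y i by field_simp [hy i],
      show (t * 1)⁻¹ = y i / (t * y i) by field_simp [hy i]] at h
  have hoff : vand (fun i => t ^ (-(μ i : ℤ)) * y i)
        * ∏ i, ∏ j ∈ Finset.Ioi i, (qPoch (t ^ μ i * y j / y i) t⁻¹ (μ j)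
          * qPoch (t ^ μ j * y i / y j) t⁻¹ (μ i))
      = t ^ (∑ i, ∑ j ∈ Finset.Ioi i, μ i * μ j) * vand y
        * ∏ i, ∏ j ∈ Finset.Ioi i, (qPoch (y j / (t * y i)) t⁻¹ (μ j)
          * qPoch (y i / (t * y j)) t⁻¹ (μ i)) := by
    simp only [vand, ← Finset.prod_pow_eq_pow_sum, ← Finset.prod_mul_distrib (s := Finset.univ)]
    refine Finset.prod_congr rfl fun i _ => ?_
    simp only [← Finset.prod_mul_distrib (s := Finset.Ioi i)]
    exact Finset.prod_congr rfl fun j _ => qPoch_pair_identity ht (hy i) (hy j) _ _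
  rw [prod_prod_eq_diag_mul_Ioi fun i j => qPoch (t ^ μ j * y i / y j) t⁻¹ (μ i),
    prod_prod_eq_diag_mul_Ioi fun i j => qPoch (y i / (t * y j)) t⁻¹ (μ i), hdiag,
    sum_mul_succ_div_two, pow_add, mul_left_comm, hoff]
  ring

/-- **Vandermonde/`q`-shifted factorial identity used to rewrite the deformed
Macdonald–Ruijsenaars coefficients**:
`(Δ(t^{-μ} y)/Δ(y)) ∏_{i,j} (y_i/(t y_j);t⁻¹)_{μ_i}⁻¹
  = (-1)^{|μ|} t^{|μ|(|μ|+1)/2} ∏_{i,j} (t^{μ_j} y_i/y_j;t⁻¹)_{μ_i}⁻¹`,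
provided all factors occurring in a denominator are nonzero. -/
theorem vandermonde_qPoch_identity (m : ℕ) (t : ℂ) (ht0 : t ≠ 0)
    (htru : ∀ k : ℕ, 1 ≤ k → t ^ k ≠ 1)
    (μ : Fin m → ℕ) (y : Fin m → ℂ)
    (hy : ∀ j, y j ≠ 0) (hvand : vand y ≠ 0)
    (hden1 : ∀ i j : Fin m, qPoch (y i / (t * y j)) t⁻¹ (μ i) ≠ 0)
    (hden2 : ∀ i j : Fin m, qPoch (t ^ μ j * y i / y j) t⁻¹ (μ i) ≠ 0) :
    vand (fun i => t ^ (-(μ i : ℤ)) * y i) / vand y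
        * ∏ i : Fin m, ∏ j : Fin m, (qPoch (y i / (t * y j)) t⁻¹ (μ i))⁻¹
      = (-1 : ℂ) ^ (∑ i, μ i) * t ^ ((∑ i, μ i) * ((∑ i, μ i) + 1) / 2)
          * ∏ i : Fin m, ∏ j : Fin m, (qPoch (t ^ μ j * y i / y j) t⁻¹ (μ i))⁻¹ := by
  have h₁ : ∏ i : Fin m, ∏ j : Fin m, qPoch (y i / (t * y j)) t⁻¹ (μ i) ≠ 0 :=
    Finset.prod_ne_zero_iff.2 fun i _ => Finset.prod_ne_zero_iff.2 fun j _ => hden1 i j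
  have h₂ : ∏ i : Fin m, ∏ j : Fin m, qPoch (t ^ μ j * y i / y j) t⁻¹ (μ i) ≠ 0 :=
    Finset.prod_ne_zero_iff.2 fun i _ => Finset.prod_ne_zero_iff.2 fun j _ => hden2 i j
  simp only [Finset.prod_inv_distrib]
  rw [← div_eq_mul_inv, ← div_eq_mul_inv, div_div, div_eq_div_iff (mul_ne_zero hvand h₁) h₂,
    vand_mul_prod_qPoch ht0 μ y hy]
  ring
end
end

section
/- Vandermonde ratio identity for 0-1 shifts: Let m ∈ ℕ, q ∈ ℂ∖{0}, I ⊆ {1,…,m}, and y ∈ ℂ^m. Then, provided all factors occurring in a denominator are nonzero, (Δ(q^I y)/Δ(y)) · ∏_{i∈I} ∏_{j=1}^{m} (1 - y_i/(q y_j))/(1 - q y_i/y_j) = (-1)^{|I|} q^{|I|(|I|-1)/2 - m|I|} ∏_{i∈I, j∉I, 1≤i,j≤m} (y_i - q y_j)/(y_i - y_j), where q^I y = (q^{I_1} y_1, …, q^{I_m} y_m) with I_j = 1 if j ∈ I and I_j = 0 otherwise, and |I| is the cardinality of I. -/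
open Finset

noncomputable section

/-- Half of the ordered pairs of distinct elements of `I` are increasing. -/
lemma sum_Ioi_mem_indicator {m : ℕ} (I : Finset (Fin m)) :
    ∑ i : Fin m, ∑ j ∈ Finset.Ioi i, (if i ∈ I ∧ j ∈ I then 1 else 0)
      = I.card * (I.card - 1) / 2 := by
  have key := Finset.sum_sum_Ioi_add_eq_sum_sum_off_diag
    (fun i j : Fin m => if i ∈ I ∧ j ∈ I then (1 : ℕ) else 0)
  have hoff : ∑ i : Fin m, ∑ j ∈ ({i}ᶜ : Finset (Fin m)), (if j ∈ I ∧ i ∈ I then (1 : ℕ) else 0)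
      = I.card * (I.card - 1) := by
    have hrow : ∀ i : Fin m, ∑ j ∈ ({i}ᶜ : Finset (Fin m)), (if j ∈ I ∧ i ∈ I then (1 : ℕ) else 0)
        = if i ∈ I then I.card - 1 else 0 := by
      intro i
      by_cases hi : i ∈ I
      · simp only [hi, and_true, if_true, Finset.sum_boole, Nat.cast_id]
        rw [← Finset.card_erase_of_mem hi]
        congr 1
        ext j
        simp
      · simp [hi]
    simp only [hrow, Finset.sum_ite_mem, Finset.univ_inter, Finset.sum_const, smul_eq_mul]
  have hdouble : ∑ i : Fin m, ∑ j ∈ Finset.Ioi i,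
        ((if j ∈ I ∧ i ∈ I then (1 : ℕ) else 0) + if i ∈ I ∧ j ∈ I then 1 else 0)
      = 2 * ∑ i : Fin m, ∑ j ∈ Finset.Ioi i, (if i ∈ I ∧ j ∈ I then 1 else 0) := by
    simp only [Finset.mul_sum]
    refine Finset.sum_congr rfl fun i _ => Finset.sum_congr rfl fun j _ => ?_
    simp only [and_comm (a := j ∈ I)]
    ring
  rw [hdouble, hoff] at key
  omega

lemma vand_ne_zero_iff_injective {m : ℕ} (y : Fin m → ℂ) :
    vand y ≠ 0 ↔ Function.Injective y := by
  simp only [vand, Finset.prod_ne_zero_iff, Finset.mem_univ, Finset.mem_Ioi, true_imp_iff,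
    sub_ne_zero]
  refine ⟨fun h i j hij => ?_, fun h i j hij => h.ne hij.ne⟩
  rcases lt_trichotomy i j with hlt | heq | hlt
  · exact absurd hij (h i j hlt)
  · exact heq
  · exact absurd hij.symm (h j i hlt)

/-- Scaling the coordinates in `I` by `q` multiplies the Vandermonde product by a power of `q`
and a product over the pairs separated by `I`. -/
lemma vand_scale_div_vand {m : ℕ} (q : ℂ) (I : Finset (Fin m)) (y : Fin m → ℂ)
    (hy : Function.Injective y) :
    vand (fun j => if j ∈ I then q * y j else y j) / vand y
      = q ^ (I.card * (I.card - 1) / 2)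
        * ∏ i ∈ I, ∏ j ∈ Iᶜ, (q * y i - y j) / (y i - y j) := by
  set B : Fin m → Fin m → ℂ := fun i j =>
    if i ∈ I ∧ j ∉ I then (q * y i - y j) / (y i - y j) else 1 with hB
  have hpair : ∀ i : Fin m, ∀ j ∈ Finset.Ioi i,
      ((if i ∈ I then q * y i else y i) - (if j ∈ I then q * y j else y j)) / (y i - y j)
        = q ^ (if i ∈ I ∧ j ∈ I then 1 else 0) * (B j i * B i j) := by
    intro i j hj
    have hij : y i - y j ≠ 0 := sub_ne_zero.2 (hy.ne (Finset.mem_Ioi.1 hj).ne)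
    have hji : y j - y i ≠ 0 := sub_ne_zero.2 (hy.ne (Finset.mem_Ioi.1 hj).ne')
    by_cases hi : i ∈ I <;> by_cases hj : j ∈ I <;> simp [hB, hi, hj, hij]
    · field_simp
    · rw [div_eq_div_iff hij hji]
      ring
  have hcross : ∏ i : Fin m, ∏ j ∈ ({i}ᶜ : Finset (Fin m)), B j i
      = ∏ i ∈ I, ∏ j ∈ Iᶜ, (q * y i - y j) / (y i - y j) := by
    have hfull : ∀ i : Fin m, ∏ j ∈ ({i}ᶜ : Finset (Fin m)), B j i = ∏ j : Fin m, B j i := by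
      intro i
      refine Finset.prod_subset (Finset.subset_univ _) fun j _ hj => ?_
      obtain rfl : j = i := by simpa using hj
      simp [hB]
    simp only [hfull]
    rw [Finset.prod_comm, ← Finset.prod_subset (Finset.subset_univ I)]
    · refine Finset.prod_congr rfl fun i hi => ?_
      rw [← Finset.prod_subset (Finset.subset_univ Iᶜ)]
      · refine Finset.prod_congr rfl fun j hj => ?_
        simp [hB, hi, Finset.mem_compl.1 hj]
      · intro j _ hj
        simp [hB, Finset.notMem_compl.1 hj]
    · intro i _ hi
      simp [hB, hi]
  simp only [vand, ← Finset.prod_div_distrib]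
  rw [Finset.prod_congr rfl fun i _ => Finset.prod_congr rfl (hpair i)]
  simp only [Finset.prod_mul_distrib (f := fun j => q ^ _),
    Finset.prod_mul_distrib (g := fun i => ∏ j ∈ Finset.Ioi i, B j i * B i j)]
  rw [Finset.prod_prod_Ioi_mul_eq_prod_prod_off_diag, hcross, ← sum_Ioi_mem_indicator]
  simp only [Finset.prod_pow_eq_pow_sum]

/-- A quotient of a function by the negative of its transpose multiplies out to a sign. -/
lemma prod_prod_div_neg_swap {ι : Type*} (I : Finset ι) (h : ι → ι → ℂ)
    (hne : ∀ i ∈ I, ∀ j ∈ I, h i j ≠ 0) :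
    ∏ i ∈ I, ∏ j ∈ I, h i j / -h j i = (-1 : ℂ) ^ I.card := by
  have hN : ∏ i ∈ I, ∏ j ∈ I, h i j ≠ 0 :=
    Finset.prod_ne_zero_iff.2 fun i hi => Finset.prod_ne_zero_iff.2 (hne i hi)
  have hterm : ∀ i j, h i j / -h j i = -1 * (h i j / h j i) := fun i j => by
    rw [div_neg, neg_one_mul]
  simp only [hterm, Finset.prod_mul_distrib, Finset.prod_div_distrib, Finset.prod_const]
  rw [Finset.prod_comm (f := fun i j => h j i), div_self hN, mul_one, ← pow_mul]
  rcases Nat.even_or_odd I.card with he | ho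
  · rw [he.neg_one_pow, (he.mul_left _).neg_one_pow]
  · rw [ho.neg_one_pow, (ho.mul ho).neg_one_pow]

/-- **Vandermonde ratio identity for 0-1 shifts**:
`(Δ(q^I y)/Δ(y)) ∏_{i∈I} ∏_{j=1}^{m} (1 - y_i/(q y_j))/(1 - q y_i/y_j)
  = (-1)^{|I|} q^{|I|(|I|-1)/2 - m|I|} ∏_{i∈I, j∉I} (y_i - q y_j)/(y_i - y_j)`,
provided all factors occurring in a denominator are nonzero. -/
theorem vandermonde_ratio_identity (m : ℕ) (q : ℂ) (hq : q ≠ 0)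
    (I : Finset (Fin m)) (y : Fin m → ℂ)
    (hy : ∀ j, y j ≠ 0) (hvand : vand y ≠ 0)
    (hden : ∀ i ∈ I, ∀ j : Fin m, 1 - q * y i / y j ≠ 0) :
    vand (fun j => if j ∈ I then q * y j else y j) / vand y
        * ∏ i ∈ I, ∏ j : Fin m, (1 - y i / (q * y j)) / (1 - q * y i / y j)
      = (-1 : ℂ) ^ I.card
          * q ^ (((I.card * (I.card - 1) / 2 : ℕ) : ℤ) - (m : ℤ) * (I.card : ℤ))
          * ∏ i ∈ I, ∏ j ∈ Iᶜ, (y i - q * y j) / (y i - y j) := by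
  have hinj := (vand_ne_zero_iff_injective y).1 hvand
  have hd : ∀ i ∈ I, ∀ j, y j - q * y i ≠ 0 := fun i hi j h0 => hden i hi j <| by
    rw [← sub_eq_zero.1 h0, div_self (hy j), sub_self]
  have hterm : ∀ i ∈ I, ∀ j, (1 - y i / (q * y j)) / (1 - q * y i / y j)
      = q⁻¹ * ((q * y j - y i) / -(q * y i - y j)) := by
    intro i hi j
    have h1 := hy j
    have h2 := hd i hi j
    have h3 : 1 - q * y i / y j = (y j - q * y i) / y j := by field_simp
    have h4 : 1 - y i / (q * y j) = (q * y j - y i) / (q * y j) := by field_simp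
    rw [h3, h4, neg_sub]
    field_simp
  have hself : ∏ i ∈ I, ∏ j ∈ I, (q * y j - y i) / -(q * y i - y j) = (-1 : ℂ) ^ I.card :=
    prod_prod_div_neg_swap I (fun i j => q * y j - y i) fun i _ j hj h0 =>
      hd j hj i (by rw [← neg_sub, h0, neg_zero])
  have hcross : (∏ i ∈ I, ∏ j ∈ Iᶜ, (q * y i - y j) / (y i - y j))
        * ∏ i ∈ I, ∏ j ∈ Iᶜ, (q * y j - y i) / -(q * y i - y j)
      = ∏ i ∈ I, ∏ j ∈ Iᶜ, (y i - q * y j) / (y i - y j) := by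
    simp only [← Finset.prod_mul_distrib]
    refine Finset.prod_congr rfl fun i hi => Finset.prod_congr rfl fun j hj => ?_
    have hij : y i - y j ≠ 0 := sub_ne_zero.2 <| hinj.ne fun h =>
      Finset.mem_compl.1 hj (h ▸ hi)
    have h2 : q * y i - y j ≠ 0 := fun h0 => hd i hi j (by rw [← neg_sub, h0, neg_zero])
    field_simp
    ring
  have hpow : q ^ (((I.card * (I.card - 1) / 2 : ℕ) : ℤ) - (m : ℤ) * (I.card : ℤ))
      = q ^ (I.card * (I.card - 1) / 2) * (q⁻¹ ^ m) ^ I.card := by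
    rw [zpow_sub₀ hq, zpow_natCast, ← Nat.cast_mul, zpow_natCast, ← pow_mul, inv_pow,
      div_eq_mul_inv]
  rw [vand_scale_div_vand q I y hinj,
    Finset.prod_congr rfl fun i hi => Finset.prod_congr rfl fun j _ => hterm i hi j]
  simp only [Finset.prod_mul_distrib, Finset.prod_const, Finset.card_univ, Fintype.card_fin]
  simp only [← Finset.prod_mul_prod_compl I, Finset.prod_mul_distrib]
  rw [hself, hpow, ← hcross]
  ring
end
end
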